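/- Fix a prime power q and integers s > r ≥ 1. There exist a positive integer Δ depending only on q, s and r, and a constant C depending only on q and s, such that for all sufficiently large n the following holds. If θ ≥ q^{−n/2} and J ∈ Z^{Gr_q(n,r)} is θ-bounded, then there exist Φ ∈ Z^{Gr_q(n,s)} and J' ∈ Z^{Gr_q(n,r)} with ∂_{s,r}Φ = J − J', such that J', ∂_{s,r}Φ⁺ and ∂_{s,r}Φ⁻ are all Cθ-bounded and |J'_R| ≤ Δ for every R ∈ Gr_q(n,r). -/

import Mathlib

open scoped Classical

noncomputable section

/-- The type of `k`-dimensional `F`-linear subspaces of `F^n`. -/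
abbrev Gr (F : Type) [Field F] (n k : ℕ) : Type :=
  {W : Submodule F (Fin n → F) // Module.finrank F W = k}

/-- The Gaussian binomial coefficient `[n choose k]_q` where `q = #F`. -/
def gbinom (F : Type) [Field F] [Fintype F] (n k : ℕ) : ℕ :=
  Nat.card (Gr F n k)

/-- The boundary map `∂_{a,b} : ℤ^{Gr_q(n,a)} → ℤ^{Gr_q(n,b)}` sending `e_S` to the sum of
`e_R` over `b`-dimensional subspaces `R ≤ S`. -/
def bdry (F : Type) [Field F] (n a b : ℕ) (Φ : Gr F n a → ℤ) : Gr F n b → ℤ :=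
  fun R => ∑ᶠ S : Gr F n a, if R.1 ≤ S.1 then Φ S else 0

/-- The positive part `Φ⁺` of an integer vector. -/
def pPart {α : Type} (Φ : α → ℤ) : α → ℤ := fun x => max (Φ x) 0

/-- The negative part `Φ⁻` of an integer vector, so `Φ = Φ⁺ + Φ⁻`. -/
def nPart {α : Type} (Φ : α → ℤ) : α → ℤ := fun x => min (Φ x) 0

/-- `J ∈ ℤ^{Gr_q(n,r)}` is `θ`-bounded: `‖∂_{r,r−1}J^±‖_∞ ≤ θ·q^n`. -/
def IsBounded (F : Type) [Field F] [Fintype F] (n r : ℕ) (θ : ℝ)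
    (J : Gr F n r → ℤ) : Prop :=
  ∀ Q : Gr F n (r - 1),
    |((bdry F n r (r - 1) (pPart J) Q : ℤ) : ℝ)| ≤ θ * (Fintype.card F : ℝ) ^ n ∧
    |((bdry F n r (r - 1) (nPart J) Q : ℤ) : ℝ)| ≤ θ * (Fintype.card F : ℝ) ^ n

/-! ### Rounding -/

/-- Along a nonzero direction `z` supported on the non-integral coordinates of `x`, one can move
until a further coordinate becomes integral, without leaving the integer box around `x`. -/
theorem exists_move_to_integral {κ : Type*} [Fintype κ] (x z : κ → ℝ) (hz : z ≠ 0)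
    (hsupp : ∀ j, Int.fract (x j) = 0 → z j = 0) :
    ∃ c : ℝ, (∀ j, (⌊x j⌋ : ℝ) ≤ x j + c * z j ∧ x j + c * z j ≤ (⌈x j⌉ : ℝ)) ∧
      ∃ j, Int.fract (x j) ≠ 0 ∧ Int.fract (x j + c * z j) = 0 := by
  let d : κ → ℝ := fun j => if 0 < z j then (⌈x j⌉ - x j) / z j else (⌊x j⌋ - x j) / z j
  have hne : (Finset.univ.filter fun j => z j ≠ 0).Nonempty := by
    obtain ⟨j, hj⟩ := Function.ne_iff.mp hz
    exact ⟨j, by simpa using hj⟩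
  obtain ⟨j₀, hj₀, hmin⟩ := Finset.exists_min_image _ d hne
  have hj₀' : z j₀ ≠ 0 := by simpa using hj₀
  have hd : ∀ j, 0 ≤ d j := by
    intro j
    simp only [d]
    split_ifs with h
    · exact div_nonneg (by linarith [Int.le_ceil (x j)]) h.le
    · exact div_nonneg_of_nonpos (by linarith [Int.floor_le (x j)]) (not_lt.mp h)
  refine ⟨d j₀, fun j => ?_, j₀, fun h => hj₀' (hsupp j₀ h), ?_⟩
  · have h1 := Int.floor_le (x j)
    have h2 := Int.le_ceil (x j)
    rcases lt_trichotomy (z j) 0 with h | h | h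
    · have hm := hmin j (by simpa using h.ne)
      have h0 := hd j₀
      have : d j * z j = ⌊x j⌋ - x j := by
        simp only [d, if_neg h.not_gt, div_mul_cancel₀ _ h.ne]
      constructor <;> nlinarith
    · simp [h, h1, h2]
    · have hm := hmin j (by simpa using h.ne')
      have h0 := hd j₀
      have : d j * z j = ⌈x j⌉ - x j := by
        simp only [d, if_pos h, div_mul_cancel₀ _ h.ne']
      constructor <;> nlinarith
  · simp only [d]
    split_ifs with h
    · rw [div_mul_cancel₀ _ hj₀']
      simp
    · rw [div_mul_cancel₀ _ hj₀']
      simp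

/-- If all columns of `A` have `ℓ¹`-norm at most `t`, then for every set `T` of columns that is
nonempty there is a nonzero vector supported on `T` and annihilated by every row whose restriction
to `T` has `ℓ¹`-norm larger than `t`. -/
theorem exists_annihilated_by_heavy_rows {ι κ : Type*} [Fintype ι] [Fintype κ] (A : ι → κ → ℝ)
    (t : ℝ) (ht : 0 ≤ t) (hA : ∀ j, ∑ i, |A i j| ≤ t) (T : Finset κ) (hT : T.Nonempty) :
    ∃ z : κ → ℝ, z ≠ 0 ∧ (∀ j ∉ T, z j = 0) ∧
      ∀ i, t < ∑ j ∈ T, |A i j| → ∑ j, A i j * z j = 0 := by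
  let H : Finset ι := Finset.univ.filter fun i => t < ∑ j ∈ T, |A i j|
  have hcard : H.card < T.card := by
    rcases H.eq_empty_or_nonempty with h | h
    · rw [h]; simpa using hT
    have h1 : (H.card : ℝ) * t < ∑ i ∈ H, ∑ j ∈ T, |A i j| := by
      rw [← nsmul_eq_mul, ← Finset.sum_const]
      exact Finset.sum_lt_sum_of_nonempty h fun i hi => (Finset.mem_filter.mp hi).2
    have h2 : ∑ i ∈ H, ∑ j ∈ T, |A i j| ≤ T.card * t := by
      rw [Finset.sum_comm, ← nsmul_eq_mul, ← Finset.sum_const]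
      refine Finset.sum_le_sum fun j _ => le_trans ?_ (hA j)
      exact Finset.sum_le_sum_of_subset_of_nonneg (Finset.subset_univ _)
        fun _ _ _ => abs_nonneg _
    by_contra hlt
    have : (T.card : ℝ) ≤ H.card := by exact_mod_cast not_lt.mp hlt
    nlinarith
  let f : (T → ℝ) →ₗ[ℝ] (H → ℝ) := Matrix.mulVecLin (Matrix.of fun i j => A i.1 j.1)
  have hker : LinearMap.ker f ≠ ⊥ := by
    apply LinearMap.ker_ne_bot_of_finrank_lt
    simpa using hcard
  obtain ⟨w, hw, hw0⟩ := Submodule.exists_mem_ne_zero_of_ne_bot hker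
  refine ⟨fun j => if h : j ∈ T then w ⟨j, h⟩ else 0, ?_, fun j hj => by simp [hj], ?_⟩
  · obtain ⟨j, hj⟩ := Function.ne_iff.mp hw0
    exact Function.ne_iff.mpr ⟨j.1, by simpa using hj⟩
  · intro i hi
    have h := congrFun (LinearMap.mem_ker.mp hw) ⟨i, by simpa [H] using hi⟩
    simp only [f, Matrix.mulVecLin_apply, Matrix.mulVec, dotProduct, Matrix.of_apply,
      Pi.zero_apply] at h
    refine Eq.trans ?_ h
    rw [← Finset.sum_subset (Finset.subset_univ T) (fun j _ hj => by simp [hj]),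
      ← Finset.sum_coe_sort T]
    simp

/-- The Beck–Fiala rounding theorem: if all columns of `A` have `ℓ¹`-norm at most `t`, then every
real vector can be rounded coordinatewise so that every row sum changes by at most `t`. -/
theorem beck_fiala_rounding {ι κ : Type*} [Fintype ι] [Fintype κ] (A : ι → κ → ℝ)
    (t : ℝ) (ht : 0 ≤ t) (hA : ∀ j, ∑ i, |A i j| ≤ t) (x : κ → ℝ) :
    ∃ y : κ → ℤ, (∀ j, ⌊x j⌋ ≤ y j ∧ y j ≤ ⌈x j⌉) ∧
      ∀ i, |∑ j, A i j * (x j - y j)| ≤ t := by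
  induction hm : (Finset.univ.filter fun j => Int.fract (x j) ≠ 0).card using
    Nat.strong_induction_on generalizing x with
  | _ m ih =>
  set T := Finset.univ.filter fun j => Int.fract (x j) ≠ 0 with hTdef
  have hTn : ∀ j ∉ T, x j = ⌊x j⌋ := by
    intro j hj
    have : Int.fract (x j) = 0 := by simpa [hTdef] using hj
    linarith [Int.floor_add_fract (x j)]
  rcases T.eq_empty_or_nonempty with hT | hT
  · refine ⟨fun j => ⌊x j⌋, fun j => ⟨le_rfl, Int.floor_le_ceil _⟩, fun i => ?_⟩
    rw [Finset.sum_eq_zero]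
    · simpa using ht
    · intro j _
      rw [← hTn j (by simp [hT])]
      simp
  obtain ⟨z, hz, hzT, hzH⟩ := exists_annihilated_by_heavy_rows A t ht hA T hT
  obtain ⟨c, hbox, j₀, hj₀, hj₀'⟩ := exists_move_to_integral x z hz
    (fun j hj => hzT j (by simpa [hTdef] using hj))
  obtain ⟨y, hy, hyA⟩ := ih _ (by
    rw [← hm]
    apply Finset.card_lt_card
    rw [Finset.ssubset_iff_of_subset]
    · exact ⟨j₀, by simpa [hTdef] using hj₀, by simpa using hj₀'⟩
    · intro j hj
      by_contra hjT
      rw [Finset.mem_filter] at hj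
      apply hj.2
      rw [hzT j hjT, hTn j hjT]
      simp) (fun j => x j + c * z j) rfl
  have hy' : ∀ j, ⌊x j⌋ ≤ y j ∧ y j ≤ ⌈x j⌉ := fun j =>
    ⟨(Int.le_floor.mpr (hbox j).1).trans (hy j).1, (hy j).2.trans (Int.ceil_le.mpr (hbox j).2)⟩
  refine ⟨y, hy', fun i => ?_⟩
  by_cases hi : t < ∑ j ∈ T, |A i j|
  · have h0 := hzH i hi
    have : ∑ j, A i j * (x j + c * z j - y j) = ∑ j, A i j * (x j - y j) := by
      rw [← sub_eq_zero, ← Finset.sum_sub_distrib]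
      calc _ = ∑ j, c * (A i j * z j) := Finset.sum_congr rfl fun j _ => by ring
        _ = 0 := by rw [← Finset.mul_sum, h0, mul_zero]
    rw [← this]
    exact hyA i
  · rw [← Finset.sum_subset (Finset.subset_univ T)]
    · refine (Finset.abs_sum_le_sum_abs _ _).trans (le_trans ?_ (not_lt.mp hi))
      refine Finset.sum_le_sum fun j _ => ?_
      rw [abs_mul]
      refine mul_le_of_le_one_right (abs_nonneg _) ?_
      have h1 : (⌊x j⌋ : ℝ) ≤ y j := by exact_mod_cast (hy' j).1
      have h2 : (y j : ℝ) ≤ ⌈x j⌉ := by exact_mod_cast (hy' j).2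
      have h3 := Int.lt_floor_add_one (x j)
      have h4 := Int.ceil_lt_add_one (x j)
      rw [abs_le]
      constructor <;> linarith
    · intro j _ hj
      have hx := hTn j hj
      have h1 := (hy' j).1
      have h2 := (hy' j).2
      rw [hx] at h2
      simp only [Int.ceil_intCast] at h2
      have : y j = ⌊x j⌋ := le_antisymm h2 h1
      rw [this, ← hx]
      simp

/-! ### Counting subspaces -/

theorem card_submodule_filter {F : Type} [Field F] [Fintype F] {n : ℕ}
    (X : Submodule F (Fin n → F)) :
    ((Finset.univ.filter fun v : Fin n → F => v ∈ X).card : ℝ) =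
      (Fintype.card F : ℝ) ^ Module.finrank F X := by
  rw [← Fintype.card_subtype]
  have := Module.card_eq_pow_finrank (K := F) (V := X)
  rw [← Nat.cast_pow, ← this]

theorem card_submodule_sdiff_filter {F : Type} [Field F] [Fintype F] {n : ℕ}
    {X Y : Submodule F (Fin n → F)} (h : X ≤ Y) :
    ((Finset.univ.filter fun v : Fin n → F => v ∈ Y ∧ v ∉ X).card : ℝ) =
      (Fintype.card F : ℝ) ^ Module.finrank F Y - (Fintype.card F : ℝ) ^ Module.finrank F X := by
  rw [← card_submodule_filter, ← card_submodule_filter, eq_sub_iff_add_eq, ← Nat.cast_add]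
  congr 1
  rw [← Finset.card_union_of_disjoint]
  · congr 1
    ext v
    simp only [Finset.mem_union, Finset.mem_filter, Finset.mem_univ, true_and]
    have := @h v
    tauto
  · rw [Finset.disjoint_filter]
    tauto

/-- The number of `k`-dimensional subspaces containing `X`, as a real number. -/
def upCount (F : Type) [Field F] [Fintype F] (n k : ℕ) (X : Submodule F (Fin n → F)) : ℝ :=
  ∑ S : Gr F n k, if X ≤ S.1 then 1 else 0

theorem sum_upCount_sup_span {F : Type} [Field F] [Fintype F] {n k : ℕ}
    (X : Submodule F (Fin n → F)) :
    ∑ v ∈ Finset.univ.filter (fun v : Fin n → F => v ∉ X), upCount F n k (X ⊔ F ∙ v) =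
      ((Fintype.card F : ℝ) ^ k - (Fintype.card F : ℝ) ^ Module.finrank F X) *
        upCount F n k X := by
  unfold upCount
  rw [Finset.sum_comm, Finset.mul_sum]
  refine Finset.sum_congr rfl fun S _ => ?_
  split_ifs with h
  · rw [mul_one]
    have h2 := card_submodule_sdiff_filter h
    rw [S.2] at h2
    rw [← h2, ← Finset.sum_filter, Finset.sum_const, nsmul_eq_mul, mul_one, Finset.filter_filter]
    congr 2
    ext v
    simp [h, and_comm]
  · rw [mul_zero]
    refine Finset.sum_eq_zero fun v _ => if_neg fun hv => h (le_sup_left.trans hv)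

/-- The number of `k`-dimensional subspaces of an `n`-dimensional space containing a given
`d`-dimensional one. -/
def upNumber (q n k d : ℕ) : ℝ :=
  if d ≤ k then ∏ i ∈ Finset.Ico d k, ((q : ℝ) ^ n - (q : ℝ) ^ i) / ((q : ℝ) ^ k - (q : ℝ) ^ i)
  else 0

theorem upNumber_succ {q n k d : ℕ} (hd : d < k) :
    upNumber q n k d =
      ((q : ℝ) ^ n - (q : ℝ) ^ d) / ((q : ℝ) ^ k - (q : ℝ) ^ d) * upNumber q n k (d + 1) := by
  rw [upNumber, upNumber, if_pos hd.le, if_pos (Nat.succ_le_of_lt hd),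
    Finset.prod_eq_prod_Ico_succ_bot hd]

theorem pow_sub_pow_pos {q i k : ℕ} (hq : 2 ≤ q) (h : i < k) :
    0 < (q : ℝ) ^ k - (q : ℝ) ^ i := by
  have : (1 : ℝ) < q := by exact_mod_cast hq
  exact sub_pos.mpr (pow_lt_pow_right₀ this h)

theorem upCount_eq_upNumber {F : Type} [Field F] [Fintype F] {n k : ℕ}
    (X : Submodule F (Fin n → F)) :
    upCount F n k X = upNumber (Fintype.card F) n k (Module.finrank F X) := by
  have hq : 2 ≤ Fintype.card F := Fintype.one_lt_card
  by_cases hX : Module.finrank F X ≤ k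
  · induction hm : k - Module.finrank F X generalizing X with
    | zero =>
      have hXk : Module.finrank F X = k := by omega
      rw [upNumber, if_pos hX, hXk, Finset.Ico_self, Finset.prod_empty, upCount,
        Finset.sum_eq_single (⟨X, hXk⟩ : Gr F n k)]
      · simp
      · intro S _ hS
        refine if_neg fun h => hS (Subtype.ext ?_)
        exact (Submodule.eq_of_le_of_finrank_eq h (hXk.trans S.2.symm)).symm
      · simp
    | succ m ih =>
      have hlt : Module.finrank F X < k := by omega
      have h1 := sum_upCount_sup_span (k := k) X
      have h2 : ∀ v ∈ Finset.univ.filter (fun v : Fin n → F => v ∉ X),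
          upCount F n k (X ⊔ F ∙ v) =
            upNumber (Fintype.card F) n k (Module.finrank F X + 1) := by
        intro v hv
        have h3 := Submodule.finrank_sup_span_singleton (K := F) (Finset.mem_filter.mp hv).2
        rw [← h3]
        exact ih _ (by omega) (by omega)
      rw [Finset.sum_congr rfl h2, Finset.sum_const, nsmul_eq_mul] at h1
      have h4 := card_submodule_sdiff_filter (le_top : X ≤ ⊤)
      simp only [Submodule.mem_top, true_and, finrank_top, Module.finrank_fin_fun] at h4
      rw [h4] at h1
      have h5 := pow_sub_pow_pos hq hlt
      rw [upNumber_succ hlt, div_mul_eq_mul_div, eq_div_iff h5.ne', h1, mul_comm]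
  · rw [upNumber, if_neg hX, upCount]
    refine Finset.sum_eq_zero fun S _ => if_neg fun h => hX ?_
    exact (Submodule.finrank_mono h).trans S.2.le

theorem upNumber_nonneg {q n k d : ℕ} (hq : 2 ≤ q) (hk : k ≤ n) : 0 ≤ upNumber q n k d := by
  unfold upNumber
  split_ifs
  · refine Finset.prod_nonneg fun i hi => ?_
    have := (Finset.mem_Ico.mp hi).2
    exact div_nonneg (pow_sub_pow_pos hq (by omega)).le (pow_sub_pow_pos hq this).le
  · exact le_rfl

theorem upNumber_mul_pow_le {q n k d : ℕ} (hq : 2 ≤ q) (hk : k ≤ n) :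
    upNumber q n k d * ((q : ℝ) ^ n) ^ d ≤ ((q : ℝ) ^ n) ^ k := by
  have hq1 : (1 : ℝ) ≤ q := by exact_mod_cast (by omega : 1 ≤ q)
  by_cases hd : d ≤ k
  · rw [upNumber, if_pos hd]
    have h : ∏ i ∈ Finset.Ico d k, ((q : ℝ) ^ n - (q : ℝ) ^ i) / ((q : ℝ) ^ k - (q : ℝ) ^ i) ≤
        ∏ i ∈ Finset.Ico d k, (q : ℝ) ^ n := by
      refine Finset.prod_le_prod (fun i hi => ?_) fun i hi => ?_
      · have := (Finset.mem_Ico.mp hi).2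
        exact div_nonneg (pow_sub_pow_pos hq (by omega)).le (pow_sub_pow_pos hq this).le
      · have hi := (Finset.mem_Ico.mp hi).2
        have h1 : (1 : ℝ) ≤ (q : ℝ) ^ k - (q : ℝ) ^ i := by
          have h2 := pow_sub_pow_pos hq hi
          have h3 : q ^ i < q ^ k := Nat.pow_lt_pow_right hq hi
          have h4 : ((q ^ i : ℕ) : ℝ) + 1 ≤ (q ^ k : ℕ) := by exact_mod_cast h3
          push_cast at h4
          linarith
        have h0 : 0 ≤ (q : ℝ) ^ i := by positivity
        have hn : 0 ≤ (q : ℝ) ^ n := by positivity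
        rw [div_le_iff₀ (by linarith)]
        nlinarith
    rw [Finset.prod_const, Nat.card_Ico] at h
    calc _ ≤ ((q : ℝ) ^ n) ^ (k - d) * ((q : ℝ) ^ n) ^ d := by gcongr
      _ = ((q : ℝ) ^ n) ^ k := by rw [← pow_add, Nat.sub_add_cancel hd]
  · rw [upNumber, if_neg hd, zero_mul]
    positivity

theorem pow_le_upNumber_mul_pow {q n k d : ℕ} (hq : 2 ≤ q) (hk : k ≤ n) (hd : d ≤ k) :
    ((q : ℝ) ^ n) ^ k ≤ (2 * (q : ℝ) ^ k) ^ k * upNumber q n k d * ((q : ℝ) ^ n) ^ d := by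
  have hq1 : (2 : ℝ) ≤ q := by exact_mod_cast hq
  have hqk : (1 : ℝ) ≤ (q : ℝ) ^ k := one_le_pow₀ (by linarith)
  have h : ∏ i ∈ Finset.Ico d k, ((q : ℝ) ^ n / (2 * (q : ℝ) ^ k)) ≤ upNumber q n k d := by
    rw [upNumber, if_pos hd]
    refine Finset.prod_le_prod (fun i hi => by positivity) fun i hi => ?_
    have hi := (Finset.mem_Ico.mp hi).2
    have h1 := pow_sub_pow_pos hq hi
    have h2 : 2 * (q : ℝ) ^ i ≤ (q : ℝ) ^ n := by
      calc 2 * (q : ℝ) ^ i ≤ q * (q : ℝ) ^ i := by gcongr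
        _ = (q : ℝ) ^ (i + 1) := by ring
        _ ≤ (q : ℝ) ^ n := pow_le_pow_right₀ (by linarith) (by omega)
    have h0 : 0 ≤ (q : ℝ) ^ i := by positivity
    rw [div_le_div_iff₀ (by positivity) h1]
    nlinarith
  rw [Finset.prod_const, Nat.card_Ico, div_pow, div_le_iff₀ (by positivity)] at h
  calc ((q : ℝ) ^ n) ^ k = ((q : ℝ) ^ n) ^ (k - d) * ((q : ℝ) ^ n) ^ d := by
        rw [← pow_add, Nat.sub_add_cancel hd]
    _ ≤ upNumber q n k d * (2 * (q : ℝ) ^ k) ^ (k - d) * ((q : ℝ) ^ n) ^ d := by gcongr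
    _ ≤ upNumber q n k d * (2 * (q : ℝ) ^ k) ^ k * ((q : ℝ) ^ n) ^ d := by
        have := upNumber_nonneg (d := d) hq hk
        gcongr
        · linarith
        · omega
    _ = _ := by ring

theorem mul_upNumber_succ_le {q n k d : ℕ} (hq : 2 ≤ q) (hk : d + k < n) (hd : d < k) :
    (q : ℝ) ^ d * upNumber q n k (d + 1) ≤ upNumber q n k d / 2 := by
  have hq1 : (2 : ℝ) ≤ q := by exact_mod_cast hq
  rw [upNumber_succ hd, mul_div_right_comm]
  refine mul_le_mul_of_nonneg_right ?_ (upNumber_nonneg hq (by omega))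
  have h1 := pow_sub_pow_pos hq hd
  rw [div_div, le_div_iff₀ (by linarith)]
  have h2 : 2 * ((q : ℝ) ^ d * (q : ℝ) ^ k) ≤ (q : ℝ) ^ n := by
    calc 2 * ((q : ℝ) ^ d * (q : ℝ) ^ k) ≤ q * ((q : ℝ) ^ d * (q : ℝ) ^ k) := by gcongr
      _ = (q : ℝ) ^ (d + k + 1) := by ring
      _ ≤ (q : ℝ) ^ n := pow_le_pow_right₀ (by linarith) (by omega)
  have h3 : (1 : ℝ) ≤ (q : ℝ) ^ d := one_le_pow₀ (by linarith)
  nlinarith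

/-- A subspace of dimension at most `s` has at most `2 ^ (q ^ s)` subspaces. -/
theorem card_submodule_le {F : Type} [Field F] [Fintype F] {n s : ℕ}
    (X : Submodule F (Fin n → F)) (hX : Module.finrank F X ≤ s) :
    (Finset.univ.filter fun L : Submodule F (Fin n → F) => L ≤ X).card ≤
      2 ^ Fintype.card F ^ s := by
  rw [← Fintype.card_subtype]
  calc _ ≤ Fintype.card (Set X) := by
        refine Fintype.card_le_of_injective (fun L => {v : X | v.1 ∈ L.1}) fun L L' h => ?_
        refine Subtype.ext (Submodule.ext fun v => ?_)
        constructor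
        · intro hv
          have : (⟨v, L.2 hv⟩ : X) ∈ {v : X | v.1 ∈ L.1} := hv
          rw [show {v : X | v.1 ∈ L.1} = {v : X | v.1 ∈ L'.1} from h] at this
          exact this
        · intro hv
          have : (⟨v, L'.2 hv⟩ : X) ∈ {v : X | v.1 ∈ L'.1} := hv
          rw [← show {v : X | v.1 ∈ L.1} = {v : X | v.1 ∈ L'.1} from h] at this
          exact this
    _ = 2 ^ Fintype.card F ^ Module.finrank F X := by
        rw [Fintype.card_set, Module.card_eq_pow_finrank (K := F)]
    _ ≤ _ := Nat.pow_le_pow_right (by norm_num) (Nat.pow_le_pow_right Fintype.card_pos hX)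

/-- The number of `k`-dimensional subspaces of a subspace of dimension at most `s` is at most
`2 ^ (q ^ s)`. -/
theorem sum_gr_le {F : Type} [Field F] [Fintype F] {n s k : ℕ}
    (X : Submodule F (Fin n → F)) (hX : Module.finrank F X ≤ s) :
    ∑ R : Gr F n k, (if R.1 ≤ X then (1 : ℝ) else 0) ≤ 2 ^ Fintype.card F ^ s := by
  have h := card_submodule_le X hX
  rw [Finset.sum_boole]
  refine le_trans (Nat.cast_le.mpr ?_) (by exact_mod_cast h :
    ((Finset.univ.filter fun L : Submodule F (Fin n → F) => L ≤ X).card : ℝ) ≤ _)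
  refine Finset.card_le_card_of_injOn (fun R => R.1) (fun R hR => ?_)
    fun R _ R' _ h => Subtype.ext h
  simpa using hR

theorem exists_between_finrank {F : Type} [Field F] [Fintype F] {n k : ℕ}
    {L R : Submodule F (Fin n → F)} (hLR : L ≤ R) (hL : Module.finrank F L ≤ k)
    (hk : k ≤ Module.finrank F R) :
    ∃ Q : Gr F n k, L ≤ Q.1 ∧ Q.1 ≤ R := by
  induction k, hL using Nat.le_induction with
  | base => exact ⟨⟨L, rfl⟩, le_rfl, hLR⟩
  | succ k hk' ih =>
    obtain ⟨Q, hLQ, hQR⟩ := ih (by omega)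
    have hne : ¬ R ≤ Q.1 := fun h => by
      have := Submodule.finrank_mono h
      rw [Q.2] at this
      omega
    obtain ⟨v, hvR, hvQ⟩ := SetLike.not_le_iff_exists.mp hne
    refine ⟨⟨Q.1 ⊔ F ∙ v, ?_⟩, hLQ.trans le_sup_left, sup_le hQR ?_⟩
    · rw [Submodule.finrank_sup_span_singleton hvQ, Q.2]
    · exact (Submodule.span_singleton_le_iff_mem _ _).mpr hvR

/-! ### Inverting the inclusion matrix -/

/-- The number of `s`-dimensional subspaces `S ≥ X` with `S ⊓ R = I`, as a real number. -/
def interCount (F : Type) [Field F] [Fintype F] (n s : ℕ) (R X I : Submodule F (Fin n → F)) : ℝ :=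
  ∑ S : Gr F n s, if X ≤ S.1 ∧ S.1 ⊓ R = I then 1 else 0

theorem finrank_sup_of_inf_le {F : Type} [Field F] {n : ℕ}
    {R X I : Submodule F (Fin n → F)} (h : X ⊓ R ≤ I)
    (hI : I ≤ R) :
    Module.finrank F (X ⊔ I : Submodule F (Fin n → F)) +
      Module.finrank F (X ⊓ R : Submodule F (Fin n → F)) =
      Module.finrank F X + Module.finrank F I := by
  have h1 : X ⊓ R = X ⊓ I :=
    le_antisymm (le_inf inf_le_left h) (inf_le_inf_left _ hI)
  rw [h1]
  exact Submodule.finrank_sup_add_finrank_inf_eq X I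

section Kernel

variable {F : Type} [Field F] [Fintype F] {n s : ℕ}

theorem interCount_nonneg (R X I : Submodule F (Fin n → F)) : 0 ≤ interCount F n s R X I :=
  Finset.sum_nonneg fun _ _ => by split_ifs <;> norm_num

theorem interCount_eq_zero {R X I : Submodule F (Fin n → F)} (h : ¬ (X ⊓ R ≤ I ∧ I ≤ R)) :
    interCount F n s R X I = 0 := by
  refine Finset.sum_eq_zero fun S _ => if_neg ?_
  rintro ⟨h1, rfl⟩
  exact h ⟨inf_le_inf_right _ h1, inf_le_right⟩

theorem sum_fiberwise_inf (R X : Submodule F (Fin n → F)) (f : Submodule F (Fin n → F) → ℝ) :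
    ∑ S : Gr F n s, (if X ≤ S.1 then f (S.1 ⊓ R) else 0) =
      ∑ I : Submodule F (Fin n → F), interCount F n s R X I * f I := by
  simp only [interCount, Finset.sum_mul]
  rw [Finset.sum_comm]
  refine Finset.sum_congr rfl fun S _ => ?_
  rw [Finset.sum_eq_single (S.1 ⊓ R)]
  · simp
  · intro I _ hI
    rw [if_neg fun h => hI h.2.symm, zero_mul]
  · simp

theorem interCount_le_upCount (R X I : Submodule F (Fin n → F)) :
    interCount F n s R X I ≤ upCount F n s (X ⊔ I) := by
  refine Finset.sum_le_sum fun S _ => ?_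
  split_ifs with h h' h'
  · exact le_rfl
  · exact absurd (sup_le h.1 (h.2.symm.le.trans inf_le_left)) h'
  · norm_num
  · exact le_rfl

theorem upCount_sup_eq_sum {R I : Submodule F (Fin n → F)} (X : Submodule F (Fin n → F))
    (hI : I ≤ R) :
    upCount F n s (X ⊔ I) =
      interCount F n s R X I +
        ∑ L : Submodule F (Fin n → F), if I < L then interCount F n s R X L else 0 := by
  have h : upCount F n s (X ⊔ I) =
      ∑ S : Gr F n s, if X ≤ S.1 then (if I ≤ S.1 ⊓ R then (1 : ℝ) else 0) else 0 := by
    refine Finset.sum_congr rfl fun S _ => ?_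
    simp only [sup_le_iff, le_inf_iff, hI, and_true, ite_and]
  rw [h, sum_fiberwise_inf R X fun L => if I ≤ L then (1 : ℝ) else 0,
    ← Finset.add_sum_erase _ _ (Finset.mem_univ I)]
  rw [← Finset.add_sum_erase Finset.univ
    (fun L => if I < L then interCount F n s R X L else 0) (Finset.mem_univ I)]
  simp only [le_refl, if_true, mul_one, lt_irrefl, if_false, zero_add]
  congr 1
  refine Finset.sum_congr rfl fun L hL => ?_
  have hL' : L ≠ I := Finset.ne_of_mem_erase hL
  by_cases h1 : I ≤ L
  · rw [if_pos h1, if_pos (lt_of_le_of_ne h1 hL'.symm), mul_one]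
  · rw [if_neg h1, if_neg fun h => h1 h.le, mul_zero]

/-- `interCount` depends on `X` only through its dimension and its intersection with `R`. -/
theorem interCount_congr {R X Y : Submodule F (Fin n → F)}
    (hdim : Module.finrank F X = Module.finrank F Y) (hXY : X ⊓ R = Y ⊓ R)
    (I : Submodule F (Fin n → F)) :
    interCount F n s R X I = interCount F n s R Y I := by
  induction I using WellFoundedGT.induction with
  | _ I ih =>
  by_cases h : X ⊓ R ≤ I ∧ I ≤ R
  · have h1 := upCount_sup_eq_sum (s := s) X h.2
    have h2 := upCount_sup_eq_sum (s := s) Y h.2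
    have h3 := finrank_sup_of_inf_le h.1 h.2
    have h4 := finrank_sup_of_inf_le (hXY ▸ h.1) h.2
    rw [hXY] at h3
    have h5 : upCount F n s (X ⊔ I) = upCount F n s (Y ⊔ I) := by
      rw [upCount_eq_upNumber, upCount_eq_upNumber]
      congr 1
      omega
    have h6 : ∑ L : Submodule F (Fin n → F), (if I < L then interCount F n s R X L else 0) =
        ∑ L : Submodule F (Fin n → F), (if I < L then interCount F n s R Y L else 0) := by
      refine Finset.sum_congr rfl fun L _ => ?_
      split_ifs with hL
      · exact ih L hL
      · rfl
    linarith
  · rw [interCount_eq_zero h, interCount_eq_zero (hXY ▸ h)]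

theorem interCount_inf_ge {r : ℕ} (hrs : r < s) (hn : r + s < n) (R X : Gr F n r) :
    upNumber (Fintype.card F) n s r / 2 ≤ interCount F n s R.1 X.1 (X.1 ⊓ R.1) := by
  have hq : 2 ≤ Fintype.card F := Fintype.one_lt_card
  have h1 : upCount F n s X.1 ≤ interCount F n s R.1 X.1 (X.1 ⊓ R.1) +
      ∑ v ∈ Finset.univ.filter (fun v : Fin n → F => v ∈ R.1 ∧ v ∉ X.1),
        upCount F n s (X.1 ⊔ F ∙ v) := by
    unfold upCount interCount
    rw [Finset.sum_comm, ← Finset.sum_add_distrib]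
    refine Finset.sum_le_sum fun S _ => ?_
    have h0 : 0 ≤ ∑ v ∈ Finset.univ.filter (fun v : Fin n → F => v ∈ R.1 ∧ v ∉ X.1),
        (if X.1 ⊔ F ∙ v ≤ S.1 then (1 : ℝ) else 0) :=
      Finset.sum_nonneg fun _ _ => by split_ifs <;> norm_num
    by_cases hX : X.1 ≤ S.1
    · by_cases hI : S.1 ⊓ R.1 = X.1 ⊓ R.1
      · rw [if_pos hX, if_pos ⟨hX, hI⟩]
        linarith
      · rw [if_pos hX, if_neg fun h => hI h.2, zero_add]
        have hne : ¬ S.1 ⊓ R.1 ≤ X.1 ⊓ R.1 := fun h =>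
          hI (le_antisymm h (inf_le_inf_right _ hX))
        obtain ⟨v, hv, hv'⟩ := SetLike.not_le_iff_exists.mp hne
        rw [Submodule.mem_inf] at hv hv'
        have hvX : v ∉ X.1 := fun h => hv' ⟨h, hv.2⟩
        have hle : X.1 ⊔ F ∙ v ≤ S.1 :=
          sup_le hX ((Submodule.span_singleton_le_iff_mem _ _).mpr hv.1)
        refine le_trans (by rw [if_pos hle]) (Finset.single_le_sum
          (f := fun v => if X.1 ⊔ F ∙ v ≤ S.1 then (1 : ℝ) else 0)
          (fun _ _ => by split_ifs <;> norm_num)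
          (Finset.mem_filter.mpr ⟨Finset.mem_univ v, hv.2, hvX⟩))
    · rw [if_neg hX, if_neg fun h => hX h.1, zero_add]
      exact h0
  have h2 : ∑ v ∈ Finset.univ.filter (fun v : Fin n → F => v ∈ R.1 ∧ v ∉ X.1),
      upCount F n s (X.1 ⊔ F ∙ v) ≤
        (Fintype.card F : ℝ) ^ r * upNumber (Fintype.card F) n s (r + 1) := by
    have h3 : ∀ v ∈ Finset.univ.filter (fun v : Fin n → F => v ∈ R.1 ∧ v ∉ X.1),
        upCount F n s (X.1 ⊔ F ∙ v) = upNumber (Fintype.card F) n s (r + 1) := by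
      intro v hv
      rw [upCount_eq_upNumber,
        Submodule.finrank_sup_span_singleton (Finset.mem_filter.mp hv).2.2, X.2]
    rw [Finset.sum_congr rfl h3, Finset.sum_const, nsmul_eq_mul]
    refine mul_le_mul_of_nonneg_right ?_ (upNumber_nonneg hq (by omega))
    have h4 := card_submodule_filter R.1
    rw [R.2] at h4
    rw [← h4, Nat.cast_le]
    exact Finset.card_le_card fun v hv => by
      simp only [Finset.mem_filter, Finset.mem_univ, true_and] at hv ⊢
      exact hv.1
  have h5 := mul_upNumber_succ_le hq hn hrs
  rw [upCount_eq_upNumber, X.2] at h1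
  linarith

/-- Coefficients, indexed by the subspaces `J` of `R`, obtained by solving a triangular system:
`S ↦ kernelCoeff R (S ⊓ R)` is a preimage of the indicator function of `R` under the
boundary map. -/
def kernelCoeff (s : ℕ) {r : ℕ} (R : Gr F n r) (J : Submodule F (Fin n → F)) : ℝ :=
  (wellFounded_gt (α := Submodule F (Fin n → F))).fix (C := fun _ => ℝ) (fun J k =>
    if h : ∃ X : Gr F n r, X.1 ⊓ R.1 = J then
      ((if J = R.1 then 1 else 0) - ∑ I : Submodule F (Fin n → F),
        if hI : J < I then interCount F n s R.1 h.choose.1 I * k I hI else 0) /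
          interCount F n s R.1 h.choose.1 J
    else 0) J

theorem kernelCoeff_of_not_exists {r : ℕ} (R : Gr F n r) {J : Submodule F (Fin n → F)}
    (h : ¬ ∃ X : Gr F n r, X.1 ⊓ R.1 = J) : kernelCoeff s R J = 0 := by
  rw [kernelCoeff, WellFounded.fix_eq, dif_neg h]

theorem kernelCoeff_inf {r : ℕ} (R X : Gr F n r) :
    kernelCoeff s R (X.1 ⊓ R.1) =
      ((if X.1 ⊓ R.1 = R.1 then 1 else 0) - ∑ I : Submodule F (Fin n → F),
        if X.1 ⊓ R.1 < I then interCount F n s R.1 X.1 I * kernelCoeff s R I else 0) /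
          interCount F n s R.1 X.1 (X.1 ⊓ R.1) := by
  have h : ∃ Y : Gr F n r, Y.1 ⊓ R.1 = X.1 ⊓ R.1 := ⟨X, rfl⟩
  have hc : ∀ I, interCount F n s R.1 h.choose.1 I = interCount F n s R.1 X.1 I :=
    interCount_congr (h.choose.2.trans X.2.symm) h.choose_spec
  conv_lhs => rw [kernelCoeff, WellFounded.fix_eq, dif_pos h]
  simp only [hc]
  rfl

/-- The function `S ↦ kernelCoeff s R (S ⊓ R)` is mapped to the indicator function of `R`. -/
theorem sum_kernelCoeff {r : ℕ} (hrs : r < s) (hn : r + s < n) (R X : Gr F n r) :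
    ∑ S : Gr F n s, (if X.1 ≤ S.1 then kernelCoeff s R (S.1 ⊓ R.1) else 0) =
      if R = X then 1 else 0 := by
  have hq : 2 ≤ Fintype.card F := Fintype.one_lt_card
  have hpos : 0 < interCount F n s R.1 X.1 (X.1 ⊓ R.1) := by
    refine lt_of_lt_of_le (half_pos ?_) (interCount_inf_ge hrs hn R X)
    rw [upNumber, if_pos hrs.le]
    refine Finset.prod_pos fun i hi => ?_
    have := (Finset.mem_Ico.mp hi).2
    exact div_pos (pow_sub_pow_pos hq (by omega)) (pow_sub_pow_pos hq this)
  have hk := kernelCoeff_inf (s := s) R X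
  rw [eq_div_iff hpos.ne'] at hk
  have hiff : X.1 ⊓ R.1 = R.1 ↔ R = X := by
    rw [inf_eq_right]
    refine ⟨fun h => Subtype.ext (Submodule.eq_of_le_of_finrank_eq h (R.2.trans X.2.symm)), ?_⟩
    rintro rfl
    exact le_rfl
  simp only [hiff] at hk
  rw [sum_fiberwise_inf, ← Finset.add_sum_erase _ _ (Finset.mem_univ (X.1 ⊓ R.1))]
  rw [← Finset.add_sum_erase Finset.univ _ (Finset.mem_univ (X.1 ⊓ R.1)), if_neg (lt_irrefl _),
    zero_add] at hk
  have he : ∑ I ∈ Finset.univ.erase (X.1 ⊓ R.1), interCount F n s R.1 X.1 I * kernelCoeff s R I =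
      ∑ I ∈ Finset.univ.erase (X.1 ⊓ R.1), if X.1 ⊓ R.1 < I then
        interCount F n s R.1 X.1 I * kernelCoeff s R I else 0 := by
    refine Finset.sum_congr rfl fun I hI => ?_
    split_ifs with h
    · rfl
    · rw [interCount_eq_zero, zero_mul]
      exact fun h' => h (lt_of_le_of_ne h'.1 (Finset.ne_of_mem_erase hI).symm)
  rw [he]
  linarith

theorem sum_interCount_mul_le (hs : s ≤ n) {R : Submodule F (Fin n → F)}
    (hR : Module.finrank F R ≤ s) (X : Submodule F (Fin n → F))
    (f : Submodule F (Fin n → F) → ℝ) {M : ℝ} (hM : 0 ≤ M)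
    (hf : ∀ I ≤ R, |f I| * ((Fintype.card F : ℝ) ^ n) ^ s ≤
      M * ((Fintype.card F : ℝ) ^ n) ^ Module.finrank F I) :
    (∑ I : Submodule F (Fin n → F), interCount F n s R X I * |f I|) *
        ((Fintype.card F : ℝ) ^ n) ^ Module.finrank F X ≤
      2 ^ Fintype.card F ^ s * M *
        ((Fintype.card F : ℝ) ^ n) ^ Module.finrank F (X ⊓ R : Submodule F (Fin n → F)) := by
  have hq : 2 ≤ Fintype.card F := Fintype.one_lt_card
  set x : ℝ := (Fintype.card F : ℝ) ^ n with hx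
  have hx1 : 1 ≤ x := one_le_pow₀ (by exact_mod_cast (by omega : 1 ≤ Fintype.card F))
  have hx0 : 0 < x := by linarith
  set d := Module.finrank F (X ⊓ R : Submodule F (Fin n → F)) with hd
  have hterm : ∀ I : Submodule F (Fin n → F),
      interCount F n s R X I * |f I| * x ^ Module.finrank F X ≤
        if I ≤ R then M * x ^ d else 0 := by
    intro I
    split_ifs with hI
    · have h1 := upNumber_mul_pow_le (d := Module.finrank F (X ⊔ I : Submodule F (Fin n → F)))
        hq hs
      rw [← upCount_eq_upNumber, ← hx] at h1
      have h2 : interCount F n s R X I *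
          x ^ Module.finrank F (X ⊔ I : Submodule F (Fin n → F)) ≤ x ^ s :=
        (mul_le_mul_of_nonneg_right (interCount_le_upCount R X I) (by positivity)).trans h1
      have h3 := Submodule.finrank_sup_add_finrank_inf_eq X I
      have h4 : Module.finrank F (X ⊓ I : Submodule F (Fin n → F)) ≤ d :=
        Submodule.finrank_mono (inf_le_inf_left _ hI)
      refine le_of_mul_le_mul_right ?_ (pow_pos hx0 (Module.finrank F I))
      calc interCount F n s R X I * |f I| * x ^ Module.finrank F X * x ^ Module.finrank F I
          = (interCount F n s R X I * x ^ Module.finrank F (X ⊔ I : Submodule F (Fin n → F))) *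
              |f I| * x ^ Module.finrank F (X ⊓ I : Submodule F (Fin n → F)) := by
            rw [mul_assoc, ← pow_add, ← h3, pow_add]
            ring
        _ ≤ x ^ s * |f I| * x ^ Module.finrank F (X ⊓ I : Submodule F (Fin n → F)) := by gcongr
        _ ≤ x ^ s * |f I| * x ^ d := by gcongr
        _ = |f I| * x ^ s * x ^ d := by ring
        _ ≤ M * x ^ Module.finrank F I * x ^ d :=
            mul_le_mul_of_nonneg_right (hf I hI) (by positivity)
        _ = M * x ^ d * x ^ Module.finrank F I := by ring
    · rw [interCount_eq_zero fun h => hI h.2]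
      simp
  rw [Finset.sum_mul]
  refine (Finset.sum_le_sum fun I _ => hterm I).trans ?_
  rw [← Finset.sum_filter, Finset.sum_const, nsmul_eq_mul, mul_assoc]
  refine mul_le_mul_of_nonneg_right ?_ (by positivity)
  exact_mod_cast card_submodule_le R hR

theorem abs_kernelCoeff_inf_le {r : ℕ} (hrs : r < s) (hn : r + s < n) (R X : Gr F n r)
    {M : ℝ} (hM : 0 ≤ M)
    (hk : ∀ I ≤ R.1, X.1 ⊓ R.1 < I → |kernelCoeff s R I| * ((Fintype.card F : ℝ) ^ n) ^ s ≤
      M * ((Fintype.card F : ℝ) ^ n) ^ Module.finrank F I) :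
    |kernelCoeff s R (X.1 ⊓ R.1)| * ((Fintype.card F : ℝ) ^ n) ^ s ≤
      2 * (2 * (Fintype.card F : ℝ) ^ s) ^ s * (1 + 2 ^ Fintype.card F ^ s * M) *
        ((Fintype.card F : ℝ) ^ n) ^
          Module.finrank F (X.1 ⊓ R.1 : Submodule F (Fin n → F)) := by
  have hq : 2 ≤ Fintype.card F := Fintype.one_lt_card
  have hlow := pow_le_upNumber_mul_pow (n := n) hq (by omega) hrs.le
  set x : ℝ := (Fintype.card F : ℝ) ^ n with hx
  have hx1 : 1 ≤ x := one_le_pow₀ (by exact_mod_cast (by omega : 1 ≤ Fintype.card F))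
  have hx0 : 0 < x := by linarith
  set D : ℝ := (2 * (Fintype.card F : ℝ) ^ s) ^ s with hD
  have hD0 : 0 ≤ D := by positivity
  set d := Module.finrank F (X.1 ⊓ R.1 : Submodule F (Fin n → F)) with hd
  set c := interCount F n s R.1 X.1 (X.1 ⊓ R.1) with hc
  have hge : upNumber (Fintype.card F) n s r / 2 ≤ c := interCount_inf_ge hrs hn R X
  have hxc : x ^ s ≤ 2 * D * c * x ^ r := by
    refine hlow.trans ?_
    have : D * upNumber (Fintype.card F) n s r ≤ D * (2 * c) :=
      mul_le_mul_of_nonneg_left (by linarith) hD0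
    calc _ ≤ D * (2 * c) * x ^ r := by gcongr
      _ = _ := by ring
  have hcpos : 0 < c := by
    by_contra h
    have h1 : 2 * D * c * x ^ r ≤ 0 :=
      mul_nonpos_of_nonpos_of_nonneg (mul_nonpos_of_nonneg_of_nonpos (by positivity)
        (not_lt.mp h)) (by positivity)
    linarith [pow_pos hx0 s]
  have hsum := sum_interCount_mul_le (by omega) (R.2.le.trans hrs.le) X.1
    (fun I => if X.1 ⊓ R.1 < I then kernelCoeff s R I else 0) hM (by
      intro I hI
      split_ifs with h
      · exact hk I hI h
      · simp only [abs_zero, zero_mul]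
        positivity)
  rw [X.2, ← hx, ← hd] at hsum
  set σ := ∑ I : Submodule F (Fin n → F), interCount F n s R.1 X.1 I *
    |if X.1 ⊓ R.1 < I then kernelCoeff s R I else 0| with hσ
  have hkc : |kernelCoeff s R (X.1 ⊓ R.1)| * c ≤ (if X.1 ⊓ R.1 = R.1 then 1 else 0) + σ := by
    rw [kernelCoeff_inf, ← hc, abs_div, abs_of_pos hcpos, div_mul_cancel₀ _ hcpos.ne']
    refine (abs_sub _ _).trans (add_le_add ?_ ?_)
    · split_ifs <;> simp
    · refine (Finset.abs_sum_le_sum_abs _ _).trans (Finset.sum_le_sum fun I _ => ?_)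
      split_ifs
      · rw [abs_mul, abs_of_nonneg (interCount_nonneg _ _ _)]
      · simp
  have hone : (if X.1 ⊓ R.1 = R.1 then (1 : ℝ) else 0) * x ^ r ≤ x ^ d := by
    split_ifs with h
    · rw [hd, h, R.2, one_mul]
    · rw [zero_mul]; positivity
  calc |kernelCoeff s R (X.1 ⊓ R.1)| * x ^ s
      ≤ |kernelCoeff s R (X.1 ⊓ R.1)| * (2 * D * c * x ^ r) := by gcongr
    _ = 2 * D * ((|kernelCoeff s R (X.1 ⊓ R.1)| * c) * x ^ r) := by ring
    _ ≤ 2 * D * (((if X.1 ⊓ R.1 = R.1 then 1 else 0) + σ) * x ^ r) := by gcongr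
    _ ≤ 2 * D * (x ^ d + 2 ^ Fintype.card F ^ s * M * x ^ d) := by
        rw [add_mul]
        gcongr
    _ = _ := by ring

/-- A bound, depending only on `q` and `s`, for the size of the normalized kernel coefficients. -/
def kernelConst (q s : ℕ) : ℝ :=
  2 * (2 * (q : ℝ) ^ s) ^ s * (1 + 2 * (2 * (q : ℝ) ^ s) ^ s * 2 ^ q ^ s) ^ s

theorem kernelConst_nonneg (q s : ℕ) : 0 ≤ kernelConst q s := by
  unfold kernelConst
  positivity

theorem abs_kernelCoeff_le {r : ℕ} (hrs : r < s) (hn : r + s < n) (R : Gr F n r)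
    {J : Submodule F (Fin n → F)} (hJ : J ≤ R.1) :
    |kernelCoeff s R J| * ((Fintype.card F : ℝ) ^ n) ^ s ≤
      kernelConst (Fintype.card F) s * ((Fintype.card F : ℝ) ^ n) ^ Module.finrank F J := by
  unfold kernelConst
  set x : ℝ := (Fintype.card F : ℝ) ^ n with hx
  have hx0 : 0 ≤ x := by positivity
  set D : ℝ := 2 * (2 * (Fintype.card F : ℝ) ^ s) ^ s with hD
  have hD0 : 0 ≤ D := by positivity
  set B : ℝ := 2 ^ Fintype.card F ^ s with hB
  have hB0 : 0 ≤ B := by positivity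
  have hT : 1 ≤ 1 + D * B := by nlinarith
  have key : ∀ m : ℕ, ∀ J ≤ R.1, r ≤ Module.finrank F J + m →
      |kernelCoeff s R J| * x ^ s ≤ D * (1 + D * B) ^ m * x ^ Module.finrank F J := by
    intro m
    induction m with
    | zero =>
      intro J hJ hm
      by_cases h : ∃ X : Gr F n r, X.1 ⊓ R.1 = J
      · obtain ⟨X, rfl⟩ := h
        have := abs_kernelCoeff_inf_le hrs hn R X le_rfl (fun I hI hlt => by
          have h1 := Submodule.finrank_lt_finrank_of_lt hlt
          have h2 := Submodule.finrank_mono hI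
          rw [R.2] at h2
          omega)
        simpa using this
      · rw [kernelCoeff_of_not_exists R h, abs_zero, zero_mul]
        positivity
    | succ m ih =>
      intro J hJ hm
      by_cases h : ∃ X : Gr F n r, X.1 ⊓ R.1 = J
      · obtain ⟨X, rfl⟩ := h
        have h3 := abs_kernelCoeff_inf_le hrs hn R X
          (M := D * (1 + D * B) ^ m) (by positivity) (fun I hI hlt => by
          have h1 := Submodule.finrank_lt_finrank_of_lt hlt
          exact ih I hI (by omega))
        refine h3.trans ?_
        rw [← hx, ← hD, ← hB]
        gcongr
        have : 1 ≤ (1 + D * B) ^ m := one_le_pow₀ hT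
        rw [pow_succ]
        nlinarith
      · rw [kernelCoeff_of_not_exists R h, abs_zero, zero_mul]
        positivity
  refine key s J hJ (by omega)

theorem sum_pow_inf_mul_le {r : ℕ} (hr : 1 ≤ r) (hrs : r < s) (hn : s ≤ n) (w : Gr F n r → ℝ)
    (hw : ∀ R, 0 ≤ w R) {E : ℝ}
    (hE : ∀ Q : Gr F n (r - 1), ∑ R : Gr F n r, (if Q.1 ≤ R.1 then w R else 0) ≤ E)
    (Q : Gr F n (r - 1)) :
    ∑ R : Gr F n r, w R * ((Fintype.card F : ℝ) ^ n) ^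
        Module.finrank F (Q.1 ⊓ R.1 : Submodule F (Fin n → F)) ≤
      2 ^ Fintype.card F ^ s * (((Fintype.card F : ℝ) ^ n) ^ (r - 1) * E) := by
  have hq : 2 ≤ Fintype.card F := Fintype.one_lt_card
  have hE0 : 0 ≤ E := le_trans
    (Finset.sum_nonneg fun R _ => by split_ifs; exacts [hw R, le_rfl]) (hE Q)
  set x : ℝ := (Fintype.card F : ℝ) ^ n with hx
  have hx0 : 0 ≤ x := by positivity
  have hL : ∀ L : Submodule F (Fin n → F), L ≤ Q.1 →
      ∑ R : Gr F n r, (if L ≤ R.1 then w R else 0) * x ^ Module.finrank F L ≤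
        x ^ (r - 1) * E := by
    intro L hLQ
    have hdim : Module.finrank F L ≤ r - 1 := (Submodule.finrank_mono hLQ).trans Q.2.le
    have h1 : ∑ R : Gr F n r, (if L ≤ R.1 then w R else 0) ≤ upCount F n (r - 1) L * E := by
      calc _ ≤ ∑ R : Gr F n r, ∑ Q' : Gr F n (r - 1),
              (if L ≤ Q'.1 then (if Q'.1 ≤ R.1 then w R else 0) else 0) := by
            refine Finset.sum_le_sum fun R _ => ?_
            have hnn : ∀ Q' ∈ (Finset.univ : Finset (Gr F n (r - 1))),
                0 ≤ (if L ≤ Q'.1 then (if Q'.1 ≤ R.1 then w R else 0) else 0) := by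
              intro Q' _
              split_ifs
              exacts [hw R, le_rfl, le_rfl]
            split_ifs with h
            · obtain ⟨Q', h1, h2⟩ := exists_between_finrank h hdim (by rw [R.2]; omega)
              refine le_trans ?_ (Finset.single_le_sum hnn (Finset.mem_univ Q'))
              rw [if_pos h1, if_pos h2]
            · exact Finset.sum_nonneg hnn
        _ = ∑ Q' : Gr F n (r - 1), (if L ≤ Q'.1 then 1 else 0) *
              ∑ R : Gr F n r, (if Q'.1 ≤ R.1 then w R else 0) := by
            rw [Finset.sum_comm]
            refine Finset.sum_congr rfl fun Q' _ => ?_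
            split_ifs <;> simp
        _ ≤ ∑ Q' : Gr F n (r - 1), (if L ≤ Q'.1 then 1 else 0) * E := by
            refine Finset.sum_le_sum fun Q' _ => mul_le_mul_of_nonneg_left (hE Q') ?_
            split_ifs <;> norm_num
        _ = _ := by rw [upCount, Finset.sum_mul]
    rw [← Finset.sum_mul]
    have h2 := upNumber_mul_pow_le (n := n) (k := r - 1) (d := Module.finrank F L) hq (by omega)
    rw [← upCount_eq_upNumber, ← hx] at h2
    calc _ ≤ upCount F n (r - 1) L * E * x ^ Module.finrank F L := by gcongr
      _ = upCount F n (r - 1) L * x ^ Module.finrank F L * E := by ring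
      _ ≤ _ := by gcongr
  calc _ ≤ ∑ R : Gr F n r, ∑ L ∈ Finset.univ.filter (fun L => L ≤ Q.1),
          (if L ≤ R.1 then w R else 0) * x ^ Module.finrank F L := by
        refine Finset.sum_le_sum fun R _ => ?_
        refine le_trans ?_ (Finset.single_le_sum
          (f := fun L => (if L ≤ R.1 then w R else 0) * x ^ Module.finrank F L) (fun L _ => ?_)
          (Finset.mem_filter.mpr ⟨Finset.mem_univ (Q.1 ⊓ R.1), inf_le_left⟩))
        · simp
        · split_ifs
          · exact mul_nonneg (hw R) (by positivity)
          · simp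
    _ ≤ ∑ L ∈ Finset.univ.filter (fun L => L ≤ Q.1), x ^ (r - 1) * E := by
        rw [Finset.sum_comm]
        exact Finset.sum_le_sum fun L hLQ => hL L (Finset.mem_filter.mp hLQ).2
    _ ≤ _ := by
        rw [Finset.sum_const, nsmul_eq_mul]
        refine mul_le_mul_of_nonneg_right ?_ (by positivity)
        exact_mod_cast card_submodule_le Q.1 (by rw [Q.2]; omega)

/-- A real preimage of `w` under the boundary map with controlled mass above every
`(r - 1)`-dimensional subspace. -/
theorem exists_fractional_preimage {r : ℕ} (hr : 1 ≤ r) (hrs : r < s) (hn : r + s < n)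
    (w : Gr F n r → ℝ) {E : ℝ}
    (hE : ∀ Q : Gr F n (r - 1), ∑ R : Gr F n r, (if Q.1 ≤ R.1 then |w R| else 0) ≤ E) :
    ∃ φ : Gr F n s → ℝ,
      (∀ R : Gr F n r, ∑ S : Gr F n s, (if R.1 ≤ S.1 then φ S else 0) = w R) ∧
      ∀ Q : Gr F n (r - 1), ∑ S : Gr F n s, (if Q.1 ≤ S.1 then |φ S| else 0) ≤
        (2 ^ Fintype.card F ^ s) ^ 2 * kernelConst (Fintype.card F) s * E := by
  have hK := kernelConst_nonneg (Fintype.card F) s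
  refine ⟨fun S => ∑ R : Gr F n r, w R * kernelCoeff s R (S.1 ⊓ R.1), fun X => ?_, fun Q => ?_⟩
  · calc _ = ∑ R : Gr F n r, w R *
            ∑ S : Gr F n s, (if X.1 ≤ S.1 then kernelCoeff s R (S.1 ⊓ R.1) else 0) := by
          simp only [Finset.mul_sum]
          rw [Finset.sum_comm]
          refine Finset.sum_congr rfl fun S _ => ?_
          split_ifs <;> simp
      _ = w X := by simp [sum_kernelCoeff hrs hn]
  · have hxpos : (0 : ℝ) < (Fintype.card F : ℝ) ^ n :=
      pow_pos (by exact_mod_cast Fintype.card_pos) n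
    have h1 : ∀ R : Gr F n r,
        (∑ S : Gr F n s, (if Q.1 ≤ S.1 then |kernelCoeff s R (S.1 ⊓ R.1)| else 0)) *
          ((Fintype.card F : ℝ) ^ n) ^ (r - 1) ≤
        2 ^ Fintype.card F ^ s * kernelConst (Fintype.card F) s *
          ((Fintype.card F : ℝ) ^ n) ^
            Module.finrank F (Q.1 ⊓ R.1 : Submodule F (Fin n → F)) := by
      intro R
      rw [sum_fiberwise_inf R.1 Q.1 fun I => |kernelCoeff s R I|]
      have := sum_interCount_mul_le (by omega) (R.2.le.trans hrs.le) Q.1 (kernelCoeff s R)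
        (kernelConst_nonneg (Fintype.card F) s) (fun I hI => abs_kernelCoeff_le hrs hn R hI)
      rwa [Q.2] at this
    refine le_of_mul_le_mul_right ?_ (pow_pos hxpos (r - 1))
    calc _ ≤ (∑ R : Gr F n r, |w R| * ∑ S : Gr F n s,
            (if Q.1 ≤ S.1 then |kernelCoeff s R (S.1 ⊓ R.1)| else 0)) *
              ((Fintype.card F : ℝ) ^ n) ^ (r - 1) := by
          refine mul_le_mul_of_nonneg_right ?_ (by positivity)
          simp only [Finset.mul_sum]
          rw [Finset.sum_comm]
          refine Finset.sum_le_sum fun S _ => ?_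
          split_ifs
          · refine (Finset.abs_sum_le_sum_abs _ _).trans (le_of_eq ?_)
            simp only [abs_mul]
          · simp
      _ ≤ ∑ R : Gr F n r, |w R| * (2 ^ Fintype.card F ^ s * kernelConst (Fintype.card F) s *
          ((Fintype.card F : ℝ) ^ n) ^
            Module.finrank F (Q.1 ⊓ R.1 : Submodule F (Fin n → F))) := by
          rw [Finset.sum_mul]
          refine Finset.sum_le_sum fun R _ => ?_
          rw [mul_assoc]
          exact mul_le_mul_of_nonneg_left (h1 R) (abs_nonneg _)
      _ = 2 ^ Fintype.card F ^ s * kernelConst (Fintype.card F) s *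
          ∑ R : Gr F n r, |w R| * ((Fintype.card F : ℝ) ^ n) ^
            Module.finrank F (Q.1 ⊓ R.1 : Submodule F (Fin n → F)) := by
          rw [Finset.mul_sum]
          exact Finset.sum_congr rfl fun R _ => by ring
      _ ≤ 2 ^ Fintype.card F ^ s * kernelConst (Fintype.card F) s *
          (2 ^ Fintype.card F ^ s * (((Fintype.card F : ℝ) ^ n) ^ (r - 1) * E)) := by
          refine mul_le_mul_of_nonneg_left ?_ (by positivity)
          exact sum_pow_inf_mul_le hr hrs (by omega) _ (fun R => abs_nonneg _) hE Q
      _ = _ := by ring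

end Kernel

/-! ### Flattening -/

section Flattening

variable {F : Type} [Field F] [Fintype F] {n : ℕ}

theorem bdry_eq_sum {a b : ℕ} (Φ : Gr F n a → ℤ) (R : Gr F n b) :
    bdry F n a b Φ R = ∑ S : Gr F n a, if R.1 ≤ S.1 then Φ S else 0 :=
  finsum_eq_sum_of_fintype _

theorem cast_bdry {a b : ℕ} (Φ : Gr F n a → ℤ) (R : Gr F n b) :
    ((bdry F n a b Φ R : ℤ) : ℝ) = ∑ S : Gr F n a, if R.1 ≤ S.1 then (Φ S : ℝ) else 0 := by
  rw [bdry_eq_sum]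
  push_cast
  rfl

theorem abs_bdry_le {a b : ℕ} {Φ Ψ : Gr F n a → ℤ} (h : ∀ S, |Φ S| ≤ |Ψ S|) (R : Gr F n b) :
    |((bdry F n a b Φ R : ℤ) : ℝ)| ≤
      ∑ S : Gr F n a, if R.1 ≤ S.1 then |(Ψ S : ℝ)| else 0 := by
  rw [cast_bdry]
  refine (Finset.abs_sum_le_sum_abs _ _).trans (Finset.sum_le_sum fun S _ => ?_)
  split_ifs
  · exact_mod_cast h S
  · simp

theorem abs_pPart_le {α : Type} (Φ : α → ℤ) (x : α) : |pPart Φ x| ≤ |Φ x| := by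
  unfold pPart
  rcases le_total (Φ x) 0 with h | h <;> simp [h]

theorem abs_nPart_le {α : Type} (Φ : α → ℤ) (x : α) : |nPart Φ x| ≤ |Φ x| := by
  unfold nPart
  rcases le_total (Φ x) 0 with h | h <;> simp [h]

theorem isBounded_of_sum_abs_le {r : ℕ} {θ : ℝ} {J : Gr F n r → ℤ}
    (h : ∀ Q : Gr F n (r - 1), ∑ R : Gr F n r, (if Q.1 ≤ R.1 then |(J R : ℝ)| else 0) ≤
      θ * (Fintype.card F : ℝ) ^ n) :
    IsBounded F n r θ J := fun Q =>
  ⟨(abs_bdry_le (abs_pPart_le J) Q).trans (h Q), (abs_bdry_le (abs_nPart_le J) Q).trans (h Q)⟩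

theorem IsBounded.sum_abs_le {r : ℕ} {θ : ℝ} {J : Gr F n r → ℤ} (h : IsBounded F n r θ J)
    (Q : Gr F n (r - 1)) :
    ∑ R : Gr F n r, (if Q.1 ≤ R.1 then |(J R : ℝ)| else 0) ≤
      2 * (θ * (Fintype.card F : ℝ) ^ n) := by
  obtain ⟨h1, h2⟩ := h Q
  have h3 : ∑ R : Gr F n r, (if Q.1 ≤ R.1 then |(J R : ℝ)| else 0) =
      (bdry F n r (r - 1) (pPart J) Q : ℝ) - (bdry F n r (r - 1) (nPart J) Q : ℝ) := by
    rw [cast_bdry, cast_bdry, ← Finset.sum_sub_distrib]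
    refine Finset.sum_congr rfl fun R _ => ?_
    split_ifs
    · have : |J R| = pPart J R - nPart J R := by
        unfold pPart nPart
        rcases le_total (J R) 0 with h | h <;> simp [h, abs_of_nonneg, abs_of_nonpos]
      exact_mod_cast this
    · simp
  rw [h3]
  linarith [le_abs_self (bdry F n r (r - 1) (pPart J) Q : ℝ),
    neg_abs_le (bdry F n r (r - 1) (nPart J) Q : ℝ)]

/-- The mass of the boundary of `Φ` above `Q` is bounded by a constant times the mass of `Φ`
above `Q`. -/
theorem sum_sum_abs_le {s r t : ℕ} (Φ : Gr F n s → ℤ) (Q : Gr F n t) :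
    ∑ R : Gr F n r, (if Q.1 ≤ R.1 then
      ∑ S : Gr F n s, (if R.1 ≤ S.1 then |(Φ S : ℝ)| else 0) else 0) ≤
    2 ^ Fintype.card F ^ s * ∑ S : Gr F n s, if Q.1 ≤ S.1 then |(Φ S : ℝ)| else 0 := by
  calc _ ≤ ∑ R : Gr F n r, ∑ S : Gr F n s, (if R.1 ≤ S.1 then (1 : ℝ) else 0) *
          (if Q.1 ≤ S.1 then |(Φ S : ℝ)| else 0) := by
        refine Finset.sum_le_sum fun R _ => ?_
        split_ifs with h
        · refine Finset.sum_le_sum fun S _ => ?_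
          split_ifs with h1 h2 h2
          · simp
          · exact absurd (h.trans h1) h2
          · simp
          · simp
        · refine Finset.sum_nonneg fun S _ => mul_nonneg ?_ ?_ <;> split_ifs <;> positivity
    _ = ∑ S : Gr F n s, (∑ R : Gr F n r, (if R.1 ≤ S.1 then (1 : ℝ) else 0)) *
          (if Q.1 ≤ S.1 then |(Φ S : ℝ)| else 0) := by
        rw [Finset.sum_comm]
        simp only [Finset.sum_mul]
    _ ≤ _ := by
        rw [Finset.mul_sum]
        refine Finset.sum_le_sum fun S _ => mul_le_mul_of_nonneg_right (sum_gr_le S.1 S.2.le) ?_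
        split_ifs <;> positivity

/-- Rounding of a real vector on `s`-dimensional subspaces which changes the boundary by a bounded
amount at every `r`-dimensional subspace, and increases the mass above every `t`-dimensional
subspace by a bounded amount. -/
theorem exists_rounding {s : ℕ} (r t : ℕ) (φ : Gr F n s → ℝ) :
    ∃ Φ : Gr F n s → ℤ,
      (∀ R : Gr F n r, |∑ S : Gr F n s, (if R.1 ≤ S.1 then φ S else 0) -
        ((bdry F n s r Φ R : ℤ) : ℝ)| ≤ 2 * 2 ^ Fintype.card F ^ s) ∧
      ∀ Q : Gr F n t, ∑ S : Gr F n s, (if Q.1 ≤ S.1 then |(Φ S : ℝ)| else 0) ≤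
        ∑ S : Gr F n s, (if Q.1 ≤ S.1 then |φ S| else 0) + 2 * 2 ^ Fintype.card F ^ s := by
  let ε : Gr F n s → ℝ := fun S => if 0 ≤ φ S then 1 else -1
  let A : Gr F n r ⊕ Gr F n t → Gr F n s → ℝ :=
    Sum.elim (fun R S => if R.1 ≤ S.1 then 1 else 0) (fun Q S => if Q.1 ≤ S.1 then ε S else 0)
  have hε : ∀ S, |ε S| = 1 := fun S => by simp only [ε]; split_ifs <;> simp
  obtain ⟨Φ, hΦ, hA⟩ := beck_fiala_rounding A (2 * 2 ^ Fintype.card F ^ s) (by positivity) (by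
    intro S
    rw [Fintype.sum_sum_type, two_mul]
    refine add_le_add (le_trans (le_of_eq ?_) (sum_gr_le (k := r) S.1 S.2.le))
      (le_trans (le_of_eq ?_) (sum_gr_le (k := t) S.1 S.2.le)) <;>
    · refine Finset.sum_congr rfl fun R _ => ?_
      simp only [A, Sum.elim_inl, Sum.elim_inr]
      split_ifs <;> simp [hε]) φ
  refine ⟨Φ, fun R => ?_, fun Q => ?_⟩
  · have h := hA (Sum.inl R)
    rw [cast_bdry, ← Finset.sum_sub_distrib]
    refine le_of_eq_of_le ?_ h
    congr 1
    refine Finset.sum_congr rfl fun S _ => ?_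
    simp only [A, Sum.elim_inl]
    split_ifs <;> simp
  · have h := neg_le_of_abs_le (hA (Sum.inr Q))
    have h1 : ∑ S, A (Sum.inr Q) S * (φ S - Φ S) =
        ∑ S : Gr F n s, (if Q.1 ≤ S.1 then |φ S| else 0) -
          ∑ S : Gr F n s, (if Q.1 ≤ S.1 then |(Φ S : ℝ)| else 0) := by
      rw [← Finset.sum_sub_distrib]
      refine Finset.sum_congr rfl fun S _ => ?_
      simp only [A, Sum.elim_inr]
      split_ifs with hQ
      · simp only [ε]
        split_ifs with h0
        · have h2 : (0 : ℝ) ≤ Φ S := by exact_mod_cast (Int.floor_nonneg.mpr h0).trans (hΦ S).1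
          rw [abs_of_nonneg h0, abs_of_nonneg h2]
          ring
        · have h0' := (not_le.mp h0).le
          have h2 : (Φ S : ℝ) ≤ 0 := by
            exact_mod_cast (hΦ S).2.trans (Int.ceil_le.mpr (by simpa using h0'))
          rw [abs_of_nonpos h0', abs_of_nonpos h2]
          ring
      · simp
    linarith

theorem one_le_mul_pow_of_rpow_le {q : ℕ} (hq : 1 ≤ q) {θ : ℝ}
    (hθ : (q : ℝ) ^ (-((n : ℝ) / 2)) ≤ θ) : 1 ≤ θ * (q : ℝ) ^ n := by
  have hq1 : (1 : ℝ) ≤ q := by exact_mod_cast hq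
  have h0 : (0 : ℝ) < q := by linarith
  calc (1 : ℝ) ≤ (q : ℝ) ^ ((n : ℝ) / 2) := Real.one_le_rpow hq1 (by positivity)
    _ = (q : ℝ) ^ (-((n : ℝ) / 2)) * (q : ℝ) ^ n := by
        rw [← Real.rpow_natCast, ← Real.rpow_add h0]
        congr 1
        ring
    _ ≤ θ * (q : ℝ) ^ n := by gcongr

end Flattening

/-- **Lemma 4.4 (flattening)**: with `Δ = Δ(q,s,r)` and `C = C(q,s)`, for large `n`, any
`θ`-bounded `J` (with `θ ≥ q^{-n/2}`) can be written as `J = ∂_{s,r}Φ + J'` where `J'`,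
`∂_{s,r}Φ⁺`, `∂_{s,r}Φ⁻` are `Cθ`-bounded and `|J'_R| ≤ Δ` for every `R`. -/
theorem J_flattening (q s r : ℕ) (hq : IsPrimePow q) (hr : 1 ≤ r) (hrs : r < s) :
    ∃ Δ : ℕ, 0 < Δ ∧ ∃ C : ℝ,
      ∀ (F : Type) [Field F] [Fintype F], Fintype.card F = q →
        ∃ n₀ : ℕ, ∀ n : ℕ, n₀ ≤ n →
          ∀ θ : ℝ, (q : ℝ) ^ (-((n : ℝ) / 2)) ≤ θ →
            ∀ J : Gr F n r → ℤ, IsBounded F n r θ J →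
              ∃ (Φ : Gr F n s → ℤ) (J' : Gr F n r → ℤ),
                bdry F n s r Φ = (fun R => J R - J' R) ∧
                IsBounded F n r (C * θ) J' ∧
                IsBounded F n r (C * θ) (bdry F n s r (pPart Φ)) ∧
                IsBounded F n r (C * θ) (bdry F n s r (nPart Φ)) ∧
                ∀ R : Gr F n r, |J' R| ≤ (Δ : ℤ) := by
  set B : ℝ := 2 ^ q ^ s with hB
  have hB0 : 0 ≤ B := by positivity
  set K := kernelConst q s with hK
  have hK0 : 0 ≤ K := kernelConst_nonneg q s
  refine ⟨2 * 2 ^ q ^ s, by positivity, 2 + B * (B ^ 2 * K * 2 + 2 * B), ?_⟩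
  intro F _ _ hF
  refine ⟨r + s + 1, fun n hn θ hθ J hJ => ?_⟩
  have hx1 : 1 ≤ θ * (Fintype.card F : ℝ) ^ n := by
    rw [hF]
    exact one_le_mul_pow_of_rpow_le hq.pos hθ
  obtain ⟨φ, hφ, hφQ⟩ := exists_fractional_preimage (s := s) hr hrs hn (fun R => (J R : ℝ))
    hJ.sum_abs_le
  obtain ⟨Φ, hΦ, hΦQ⟩ := exists_rounding r (r - 1) φ
  simp only [hφ, hF, ← hB, ← hK] at hΦ hΦQ hφQ
  rw [hF] at hx1
  set X : ℝ := θ * (q : ℝ) ^ n with hX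
  have hmass : ∀ Q : Gr F n (r - 1), ∑ S : Gr F n s, (if Q.1 ≤ S.1 then |(Φ S : ℝ)| else 0) ≤
      (B ^ 2 * K * 2 + 2 * B) * X := by
    intro Q
    have h1 := hΦQ Q
    have h2 := hφQ Q
    nlinarith
  have hbdry : ∀ Ψ : Gr F n s → ℤ, (∀ S, |Ψ S| ≤ |Φ S|) → ∀ Q : Gr F n (r - 1),
      ∑ R : Gr F n r, (if Q.1 ≤ R.1 then |((bdry F n s r Ψ R : ℤ) : ℝ)| else 0) ≤
        B * (B ^ 2 * K * 2 + 2 * B) * X := by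
    intro Ψ hΨ Q
    calc _ ≤ ∑ R : Gr F n r, (if Q.1 ≤ R.1 then
            ∑ S : Gr F n s, (if R.1 ≤ S.1 then |(Φ S : ℝ)| else 0) else 0) := by
          refine Finset.sum_le_sum fun R _ => ?_
          split_ifs
          · exact abs_bdry_le hΨ R
          · exact le_rfl
      _ ≤ B * ∑ S : Gr F n s, (if Q.1 ≤ S.1 then |(Φ S : ℝ)| else 0) := by
          have := sum_sum_abs_le (r := r) Φ Q
          rwa [hF] at this
      _ ≤ B * ((B ^ 2 * K * 2 + 2 * B) * X) := by gcongr; exact hmass Q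
      _ = _ := by ring
  have hCX : (2 + B * (B ^ 2 * K * 2 + 2 * B)) * θ * (Fintype.card F : ℝ) ^ n =
      2 * X + B * (B ^ 2 * K * 2 + 2 * B) * X := by
    rw [hX, hF]
    ring
  refine ⟨Φ, fun R => J R - bdry F n s r Φ R, by simp, ?_, ?_, ?_, fun R => ?_⟩
  · refine isBounded_of_sum_abs_le fun Q => ?_
    rw [hCX]
    have h1 := hJ.sum_abs_le Q
    rw [hF, ← hX] at h1
    refine le_trans ?_ (add_le_add h1 (hbdry Φ (fun _ => le_rfl) Q))
    rw [← Finset.sum_add_distrib]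
    refine Finset.sum_le_sum fun R _ => ?_
    split_ifs
    · push_cast
      exact abs_sub _ _
    · simp
  · refine isBounded_of_sum_abs_le fun Q => ?_
    rw [hCX]
    linarith [hbdry (pPart Φ) (abs_pPart_le Φ) Q]
  · refine isBounded_of_sum_abs_le fun Q => ?_
    rw [hCX]
    linarith [hbdry (nPart Φ) (abs_nPart_le Φ) Q]
  · have h := hΦ R
    rw [hB] at h
    exact_mod_cast h
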